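/- There exists a constant c > 0 such that for every integer k ≥ 1, QLB(N_k) ≥ c·k. (In fact, QLB(N_k) ≥ 4k·(H_{2k} − H_k).) -/

import Mathlib

open MeasureTheory Finset

attribute [local instance] Classical.propDecidable

noncomputable def harm (q : ℕ) : ℝ := ∑ m ∈ Finset.range q, (1 : ℝ) / (m + 1)

noncomputable def linExts (α : Type) [Fintype α] (r : α → α → Prop) :
    Finset (α ≃ Fin (Fintype.card α)) :=
  Finset.univ.filter fun σ => ∀ i j : α, r i j → σ i ≤ σ j

noncomputable def dN {α : Type} [Fintype α] (r : α → α → Prop)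
    (σ : α ≃ Fin (Fintype.card α)) (i : α) : ℕ :=
  if ∀ j : α, r j i → j = i then (σ i : ℕ) + 1
  else sInf {m : ℕ | ∃ j : α, j ≠ i ∧ r j i ∧ m = (σ i : ℕ) - (σ j : ℕ)}

noncomputable def QLB (α : Type) [Fintype α] (r : α → α → Prop) : ℝ :=
  (∑ σ ∈ linExts α r, ∑ i : α, harm (dN r σ i - 1)) / ((linExts α r).card : ℝ)

def chainPolytope (α : Type) [Fintype α] (r : α → α → Prop) : Set (α → ℝ) :=
  {y | (∀ i, 0 ≤ y i) ∧
    ∀ C : Finset α, (∀ i ∈ C, ∀ j ∈ C, r i j ∨ r j i) → ∑ i ∈ C, y i ≤ 1}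

def orderPolytope (α : Type) [Fintype α] (r : α → α → Prop) : Set (α → ℝ) :=
  {y | (∀ i, 0 ≤ y i ∧ y i ≤ 1) ∧ ∀ i j : α, r i j → y i ≤ y j}

noncomputable def transferMap (α : Type) [Fintype α] (r : α → α → Prop)
    (y : α → ℝ) (i : α) : ℝ :=
  if ∀ j : α, r j i → j = i then y i
  else sInf {t : ℝ | ∃ j : α, j ≠ i ∧ r j i ∧ t = y i - y j}

noncomputable def QH (α : Type) [Fintype α] (r : α → α → Prop) : ℝ :=
  ⨍ z in chainPolytope α r, -(1 / (Fintype.card α : ℝ)) * ∑ i : α, Real.log (z i)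

noncomputable def posetEntropy (α : Type) [Fintype α] (r : α → α → Prop) : ℝ :=
  sInf {x : ℝ | ∃ z ∈ chainPolytope α r, (∀ i, 0 < z i) ∧
    x = -(1 / (Fintype.card α : ℝ)) * ∑ i : α, Real.log (z i)}

def seriesComp {α β : Type} (r : α → α → Prop) (s : β → β → Prop) :
    α ⊕ β → α ⊕ β → Prop
  | Sum.inl x, Sum.inl y => r x y
  | Sum.inr x, Sum.inr y => s x y
  | Sum.inl _, Sum.inr _ => True
  | Sum.inr _, Sum.inl _ => False

def parallelComp {α β : Type} (r : α → α → Prop) (s : β → β → Prop) :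
    α ⊕ β → α ⊕ β → Prop
  | Sum.inl x, Sum.inl y => r x y
  | Sum.inr x, Sum.inr y => s x y
  | _, _ => False

/-- Ground set of the poset `N_k`: four copies of `Fin k` (the chains A, B, C, D). -/
abbrev NCarrier (k : ℕ) : Type := Fin k ⊕ Fin k ⊕ Fin k ⊕ Fin k

/-- The order relation of the poset `N_k`. -/
def NRel (k : ℕ) : NCarrier k → NCarrier k → Prop
  | Sum.inl i, Sum.inl j => i ≤ j
  | Sum.inl _, Sum.inr (Sum.inl _) => True
  | Sum.inr (Sum.inl i), Sum.inr (Sum.inl j) => i ≤ j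
  | Sum.inr (Sum.inr (Sum.inl i)), Sum.inr (Sum.inr (Sum.inl j)) => i ≤ j
  | Sum.inr (Sum.inr (Sum.inl _)), Sum.inr (Sum.inl _) => True
  | Sum.inr (Sum.inr (Sum.inl _)), Sum.inr (Sum.inr (Sum.inr _)) => True
  | Sum.inr (Sum.inr (Sum.inr i)), Sum.inr (Sum.inr (Sum.inr j)) => i ≤ j
  | _, _ => False

lemma harm_succ (q : ℕ) : harm (q + 1) = harm q + 1 / ((q : ℝ) + 1) := by
  simp [harm, Finset.sum_range_succ]

lemma sum_choose_div_eq (n r : ℕ) :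
    ∑ m ∈ range n, ((n - 1 - m).choose r : ℝ) / (m + 1) = n.choose r * (harm n - harm r) := by
  induction n generalizing r with
  | zero => cases r <;> simp [harm]
  | succ n ih =>
    cases r with
    | zero => simp [harm]
    | succ r =>
      have h : ∑ m ∈ range (n + 1), ((n + 1 - 1 - m).choose (r + 1) : ℝ) / (m + 1) =
          (∑ m ∈ range n, ((n - 1 - m).choose r : ℝ) / (m + 1)) +
            ∑ m ∈ range n, ((n - 1 - m).choose (r + 1) : ℝ) / (m + 1) := by
        rw [Finset.sum_range_succ, ← Finset.sum_add_distrib]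
        simp only [Nat.add_sub_cancel, Nat.sub_self, Nat.choose_zero_succ, Nat.cast_zero, zero_div,
          add_zero]
        refine Finset.sum_congr rfl fun m hm => ?_
        obtain ⟨l, rfl⟩ := Nat.exists_eq_add_of_lt (Finset.mem_range.1 hm)
        have h1 : m + l + 1 - m = l + 1 := by omega
        have h2 : m + l + 1 - 1 - m = l := by omega
        rw [h1, h2, Nat.choose_succ_succ]
        push_cast
        ring
      rw [h, ih, ih, harm_succ, harm_succ, Nat.choose_succ_succ]
      have h3 : ((n : ℝ) + 1) * n.choose r = (n.choose r + n.choose (r + 1)) * (r + 1) := by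
        have := Nat.add_one_mul_choose_eq n r
        rw [Nat.choose_succ_succ] at this
        exact_mod_cast this
      push_cast
      have hn : (n : ℝ) + 1 ≠ 0 := by positivity
      have hr : (r : ℝ) + 1 ≠ 0 := by positivity
      field_simp
      linear_combination h3

/-- The subsets of size `r + 1` of an interval that contain `s` and miss the `m + 1` integers just
below `s`. -/
lemma card_powersetCard_gap (lo hi r s m : ℕ) (hs : s ∈ Ico lo hi) (hm : m < s - lo) :
    #{T ∈ powersetCard (r + 1) (Ico lo hi) | s ∈ T ∧ ∀ t ∈ T, t < s → t + m + 1 < s} =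
      (hi - lo - 1 - m - 1).choose r := by
  rw [Finset.mem_Ico] at hs
  have hI : Icc (s - m - 1) s ⊆ Ico lo hi := by
    intro t ht
    rw [Finset.mem_Icc] at ht
    rw [Finset.mem_Ico]
    omega
  have hcard : #(Ico lo hi \ Icc (s - m - 1) s) = hi - lo - 1 - m - 1 := by
    rw [Finset.card_sdiff_of_subset hI, Nat.card_Ico, Nat.card_Icc]
    omega
  rw [← hcard, ← Finset.card_powersetCard]
  symm
  refine Finset.card_bij' (fun T _ => insert s T) (fun T _ => T.erase s) ?_ ?_ ?_ ?_
  · intro T hT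
    rw [Finset.mem_powersetCard] at hT
    have hmem : ∀ t ∈ T, (lo ≤ t ∧ t < hi) ∧ (s - m - 1 ≤ t → s < t) := by
      intro t ht
      simpa using hT.1 ht
    have hsT : s ∉ T := fun h => by have := (hmem s h).2; omega
    rw [Finset.mem_filter, Finset.mem_powersetCard]
    refine ⟨⟨?_, by rw [Finset.card_insert_of_notMem hsT, hT.2]⟩,
      Finset.mem_insert_self _ _, ?_⟩
    · intro t ht
      rcases Finset.mem_insert.1 ht with rfl | ht
      · exact Finset.mem_Ico.2 hs
      · exact Finset.mem_Ico.2 (hmem t ht).1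
    · intro t ht hts
      rcases Finset.mem_insert.1 ht with rfl | ht
      · omega
      · have := (hmem t ht).2
        omega
  · intro T hT
    rw [Finset.mem_filter, Finset.mem_powersetCard] at hT
    rw [Finset.mem_powersetCard]
    refine ⟨fun t ht => ?_, by rw [Finset.card_erase_of_mem hT.2.1, hT.1.2]; rfl⟩
    rw [Finset.mem_erase] at ht
    rw [Finset.mem_sdiff, Finset.mem_Icc]
    have := hT.2.2 t ht.2
    exact ⟨hT.1.1 ht.2, by omega⟩
  · intro T hT
    rw [Finset.mem_powersetCard] at hT
    refine Finset.erase_insert fun h => ?_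
    have := hT.1 h
    rw [Finset.mem_sdiff, Finset.mem_Icc] at this
    omega
  · intro T hT
    exact Finset.insert_erase (Finset.mem_filter.1 hT).2.1

/-- The sum of `harm (g - 1)` over the gaps `g` between consecutive elements of `T`, the first gap
being measured from `lo - 1`. -/
noncomputable def gapSum (lo : ℕ) (T : Finset ℕ) : ℝ :=
  ∑ s ∈ T, ∑ m ∈ range (s - lo), if ∀ t ∈ T, t < s → t + m + 1 < s then (1 : ℝ) / (m + 1) else 0

lemma sum_gapSum (lo hi r : ℕ) :
    ∑ T ∈ powersetCard r (Ico lo hi), gapSum lo T =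
      (hi - lo).choose r * (r * (harm (hi - lo) - harm r)) := by
  cases r with
  | zero => simp [gapSum]
  | succ r =>
    have h1 : ∀ T ∈ powersetCard (r + 1) (Ico lo hi), gapSum lo T =
        ∑ s ∈ Ico lo hi, ∑ m ∈ range (s - lo),
          if s ∈ T ∧ ∀ t ∈ T, t < s → t + m + 1 < s then (1 : ℝ) / (m + 1) else 0 := by
      intro T hT
      rw [gapSum, ← Finset.sum_subset (Finset.mem_powersetCard.1 hT).1]
      · refine Finset.sum_congr rfl fun s hs => Finset.sum_congr rfl fun m _ => ?_
        simp only [hs, true_and]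
      · intro s _ hs
        simp [hs]
    rw [Finset.sum_congr rfl h1, Finset.sum_comm]
    have h2 : ∀ s ∈ Ico lo hi, (∑ T ∈ powersetCard (r + 1) (Ico lo hi), ∑ m ∈ range (s - lo),
        if s ∈ T ∧ ∀ t ∈ T, t < s → t + m + 1 < s then (1 : ℝ) / (m + 1) else 0) =
        ∑ m ∈ range (hi - lo), if m < s - lo then
          ((hi - lo - 1 - m - 1).choose r : ℝ) / (m + 1) else 0 := by
      intro s hs
      rw [Finset.sum_comm, ← Finset.sum_filter]
      have h3 : (range (hi - lo)).filter (fun m => m < s - lo) = range (s - lo) := by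
        ext m
        simp only [Finset.mem_filter, Finset.mem_range]
        rw [Finset.mem_Ico] at hs
        omega
      rw [h3]
      refine Finset.sum_congr rfl fun m hm => ?_
      rw [← card_powersetCard_gap lo hi r s m hs (Finset.mem_range.1 hm), ← Finset.sum_filter,
        Finset.sum_const, nsmul_eq_mul, mul_one_div]
    rw [Finset.sum_congr rfl h2, Finset.sum_comm]
    have h4 : ∀ m ∈ range (hi - lo), (∑ s ∈ Ico lo hi, if m < s - lo then
        ((hi - lo - 1 - m - 1).choose r : ℝ) / (m + 1) else 0) =
        (r + 1 : ℕ) * (((hi - lo - 1 - m).choose (r + 1) : ℝ) / (m + 1)) := by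
      intro m hm
      rw [Finset.mem_range] at hm
      have h5 : (Ico lo hi).filter (fun s => m < s - lo) = Ico (lo + m + 1) hi := by
        ext s
        simp only [Finset.mem_filter, Finset.mem_Ico]
        omega
      rw [← Finset.sum_filter, h5, Finset.sum_const, Nat.card_Ico, nsmul_eq_mul]
      have h6 : hi - (lo + m + 1) = hi - lo - 1 - m := by omega
      rw [h6]
      rcases hi - lo - 1 - m with _ | l
      · simp
      · have := Nat.add_one_mul_choose_eq l r
        have h7 : ((l : ℝ) + 1) * l.choose r = (l + 1).choose (r + 1) * (r + 1) := by
          exact_mod_cast this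
        rw [Nat.add_sub_cancel]
        push_cast
        rw [mul_div_assoc', h7]
        ring
    rw [Finset.sum_congr rfl h4, ← Finset.mul_sum, sum_choose_div_eq]
    ring

lemma nth_notMem_insert (k n : ℕ) (S : Finset ℕ) (hS : S ⊆ range n) (hk : k + #S < n) :
    Nat.nth (· ∉ insert n S) k = Nat.nth (· ∉ S) k := by
  have hinf : ({x | x ∉ S}).Infinite := S.finite_toSet.infinite_compl
  have hmem : Nat.nth (· ∉ S) k ∉ S := Nat.nth_mem_of_infinite hinf k
  have hlt : Nat.nth (· ∉ S) k < n := by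
    refine Nat.nth_lt_of_lt_count ?_
    rw [Nat.count_eq_card_filter_range, ← Finset.sdiff_eq_filter, Finset.card_sdiff_of_subset hS,
      Finset.card_range]
    omega
  have hcount : Nat.count (· ∉ insert n S) (Nat.nth (· ∉ S) k) = k := by
    rw [← Nat.count_nth_of_infinite hinf k, Nat.count_nth_of_infinite hinf k,
      Nat.count_eq_card_filter_range]
    conv_rhs => rw [← Nat.count_nth_of_infinite hinf k, Nat.count_eq_card_filter_range]
    congr 1
    refine Finset.filter_congr fun t ht => ?_
    rw [Finset.mem_range] at ht
    have : t ≠ n := by omega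
    simp [this]
  have hmem' : Nat.nth (· ∉ S) k ∉ insert n S := by
    simp only [Finset.mem_insert, not_or]
    exact ⟨hlt.ne, hmem⟩
  conv_lhs => rw [← hcount]
  exact Nat.nth_count hmem'

lemma nth_notMem_of_card (k r : ℕ) (S : Finset ℕ) (hS : S ∈ powersetCard r (range (k + r))) :
    Nat.nth (· ∉ S) k = k + r := by
  rw [Finset.mem_powersetCard] at hS
  have h : Nat.count (· ∉ S) (k + r) = k := by
    rw [Nat.count_eq_card_filter_range, ← Finset.sdiff_eq_filter,
      Finset.card_sdiff_of_subset hS.1, Finset.card_range, hS.2, Nat.add_sub_cancel]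
  have hmem : k + r ∉ S := fun h => by simpa using hS.1 h
  conv_lhs => rw [← h]
  exact Nat.nth_count (p := (· ∉ S)) hmem

lemma sum_harm_nth_notMem (k r j : ℕ) :
    ∑ S ∈ powersetCard r (range (k + j + r)), harm (Nat.nth (· ∉ S) k) =
      (k + j + r).choose r * (harm (k + j + r) - harm (k + j) + harm k) := by
  induction r generalizing j with
  | zero => simp [Nat.nth_of_forall]
  | succ r ihr =>
    induction j with
    | zero =>
      rw [add_zero, Finset.sum_congr rfl fun S hS => by rw [nth_notMem_of_card k (r + 1) S hS]]
      simp
    | succ j ihj =>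
      have hn : k + (j + 1) + (r + 1) = (k + (j + 1) + r) + 1 := by omega
      rw [hn, Finset.range_add_one, Finset.powersetCard_succ_insert Finset.notMem_range_self,
        Finset.sum_union, Finset.sum_image]
      · have h1 : ∀ S ∈ powersetCard r (range (k + (j + 1) + r)),
            harm (Nat.nth (· ∉ insert (k + (j + 1) + r) S) k) = harm (Nat.nth (· ∉ S) k) := by
          intro S hS
          rw [Finset.mem_powersetCard] at hS
          rw [nth_notMem_insert k _ S hS.1 (by omega)]
        rw [Finset.sum_congr rfl h1, ihr (j + 1)]
        have hn' : k + (j + 1) + r = k + j + (r + 1) := by omega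
        rw [hn', ihj]
        have hs : k + (j + 1) = k + j + 1 := by omega
        rw [hs, harm_succ (k + j + (r + 1)), harm_succ (k + j), Nat.choose_succ_succ]
        have h3 := Nat.choose_succ_right_eq (k + j + (r + 1)) r
        have h4 : k + j + (r + 1) - r = k + j + 1 := by omega
        rw [h4] at h3
        have h5 : ((k + j + (r + 1)).choose (r + 1) : ℝ) * (r + 1) =
          (k + j + (r + 1)).choose r * (k + j + 1) := by exact_mod_cast h3
        push_cast
        field_simp
        linear_combination h5
      · intro S hS T hT hST
        have hmem : ∀ S ∈ powersetCard r (range (k + (j + 1) + r)), (k + (j + 1) + r) ∉ S :=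
          fun S hS h => by simpa using (Finset.mem_powersetCard.1 hS).1 h
        rw [← Finset.erase_insert (hmem S hS), ← Finset.erase_insert (hmem T hT)]
        exact congrArg (Finset.erase · (k + (j + 1) + r)) hST
      · rw [Finset.disjoint_left]
        intro S hS hS'
        obtain ⟨T, _, rfl⟩ := Finset.mem_image.1 hS'
        simpa using (Finset.mem_powersetCard.1 hS).1 (Finset.mem_insert_self _ _)

/-- The permutation of `ℕ` that maps `S` onto `T` and the complement of `S` onto the complement of
`T`, increasingly on both (for `S` and `T` of the same size). -/
noncomputable def shuffle (S T : Finset ℕ) (x : ℕ) : ℕ :=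
  if x ∈ S then Nat.nth (· ∈ T) (Nat.count (· ∈ S) x) else Nat.nth (· ∉ T) (Nat.count (· ∉ S) x)

section shuffle

variable {S T : Finset ℕ} {x y : ℕ}

lemma shuffle_of_mem (hx : x ∈ S) : shuffle S T x = Nat.nth (· ∈ T) (Nat.count (· ∈ S) x) :=
  if_pos hx

lemma shuffle_of_notMem (hx : x ∉ S) : shuffle S T x = Nat.nth (· ∉ T) (Nat.count (· ∉ S) x) :=
  if_neg hx

lemma infinite_notMem (S : Finset ℕ) : (Set.ofPred (· ∉ S)).Infinite :=
  S.finite_toSet.infinite_compl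

lemma count_mem_lt_card (hx : x ∈ S) : Nat.count (· ∈ S) x < #S := by
  have := Nat.count_lt_card (p := (· ∈ S)) (n := x) S.finite_toSet hx
  refine this.trans_eq (congrArg _ ?_)
  ext
  simp

lemma count_mem_lt_card_toFinset (h : #S = #T) (hx : x ∈ S) (hf : (Set.ofPred (· ∈ T)).Finite) :
    Nat.count (· ∈ S) x < #hf.toFinset := by
  have : hf.toFinset = T := by
    ext
    simp
  rw [this, ← h]
  exact count_mem_lt_card hx

lemma shuffle_mem (h : #S = #T) (hx : x ∈ S) : shuffle S T x ∈ T := by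
  rw [shuffle_of_mem hx]
  exact Nat.nth_mem (p := (· ∈ T)) _ (count_mem_lt_card_toFinset h hx)

lemma shuffle_notMem (hx : x ∉ S) : shuffle S T x ∉ T := by
  rw [shuffle_of_notMem hx]
  exact Nat.nth_mem_of_infinite (infinite_notMem T) _

lemma shuffle_shuffle (h : #S = #T) (x : ℕ) : shuffle T S (shuffle S T x) = x := by
  by_cases hx : x ∈ S
  · rw [shuffle_of_mem (shuffle_mem h hx), shuffle_of_mem hx,
      Nat.count_nth (count_mem_lt_card_toFinset h hx)]
    exact Nat.nth_count (p := (· ∈ S)) hx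
  · rw [shuffle_of_notMem (shuffle_notMem hx), shuffle_of_notMem hx,
      Nat.count_nth_of_infinite (infinite_notMem T)]
    exact Nat.nth_count (p := (· ∉ S)) hx

lemma shuffle_lt_of_mem (h : #S = #T) (hx : x ∈ S) (hy : y ∈ S) (hxy : x < y) :
    shuffle S T x < shuffle S T y := by
  rw [shuffle_of_mem hx, shuffle_of_mem hy]
  exact Nat.nth_lt_nth' (Nat.count_strict_mono (p := (· ∈ S)) hx hxy)
    (count_mem_lt_card_toFinset h hy)

lemma shuffle_lt_of_notMem (hx : x ∉ S) (hy : y ∉ S) (hxy : x < y) :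
    shuffle S T x < shuffle S T y := by
  rw [shuffle_of_notMem hx, shuffle_of_notMem hy]
  exact Nat.nth_strictMono (infinite_notMem T) (Nat.count_strict_mono (p := (· ∉ S)) hx hxy)

lemma shuffle_eq_self (h : #S = #T) {lo hi : ℕ} (hS : S ⊆ Ico lo hi) (hT : T ⊆ Ico lo hi)
    (hx : x < lo ∨ hi ≤ x) : shuffle S T x = x := by
  have key : ∀ U : Finset ℕ, U ⊆ Ico lo hi → x ∉ U := by
    intro U hU hxU
    have := Finset.mem_Ico.1 (hU hxU)
    omega
  have hcount : Nat.count (· ∉ S) x = Nat.count (· ∉ T) x := by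
    rw [Nat.count_eq_card_filter_range, Nat.count_eq_card_filter_range, ← Finset.sdiff_eq_filter,
      ← Finset.sdiff_eq_filter]
    rcases hx with hx | hx
    · have hd : ∀ U : Finset ℕ, U ⊆ Ico lo hi → range x \ U = range x := by
        intro U hU
        refine Finset.sdiff_eq_self_of_disjoint (Finset.disjoint_left.2 fun t ht htU => ?_)
        have := Finset.mem_Ico.1 (hU htU)
        have := Finset.mem_range.1 ht
        omega
      rw [hd S hS, hd T hT]
    · have hd : ∀ U : Finset ℕ, U ⊆ Ico lo hi → U ⊆ range x := by
        intro U hU t ht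
        have := Finset.mem_Ico.1 (hU ht)
        rw [Finset.mem_range]
        omega
      rw [Finset.card_sdiff_of_subset (hd S hS), Finset.card_sdiff_of_subset (hd T hT), h]
  rw [shuffle_of_notMem (key S hS), hcount]
  exact Nat.nth_count (p := (· ∉ T)) (key T hT)

lemma shuffle_lt (h : #S = #T) {N : ℕ} (hS : S ⊆ range N) (hT : T ⊆ range N) (hx : x < N) :
    shuffle S T x < N := by
  by_contra! hN
  rw [Finset.range_eq_Ico] at hS hT
  have h1 := shuffle_eq_self h.symm hT hS (Or.inr hN)
  rw [shuffle_shuffle h] at h1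
  omega

/-- `shuffle S T` as a permutation of `Fin N`. -/
noncomputable def shufflePerm {N : ℕ} (h : #S = #T) (hS : S ⊆ range N) (hT : T ⊆ range N) :
    Equiv.Perm (Fin N) where
  toFun x := ⟨shuffle S T x, shuffle_lt h hS hT x.2⟩
  invFun x := ⟨shuffle T S x, shuffle_lt h.symm hT hS x.2⟩
  left_inv x := Fin.ext (shuffle_shuffle h x)
  right_inv x := Fin.ext (shuffle_shuffle h.symm x)

end shuffle

/-- The set of positions taken by the elements of `X`. -/
noncomputable def positions {α : Type} [Fintype α] (X : Finset α)
    (σ : α ≃ Fin (Fintype.card α)) : Finset ℕ :=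
  X.image fun x => (σ x : ℕ)

section positions

variable {α : Type} [Fintype α] {X : Finset α} {σ : α ≃ Fin (Fintype.card α)}

lemma val_injective (σ : α ≃ Fin (Fintype.card α)) : Function.Injective fun x => (σ x : ℕ) :=
  Fin.val_injective.comp σ.injective

lemma mem_positions {x : α} : (σ x : ℕ) ∈ positions X σ ↔ x ∈ X :=
  ⟨fun h => by
    obtain ⟨y, hy, hyx⟩ := Finset.mem_image.1 h
    rwa [← val_injective σ hyx], fun h => Finset.mem_image_of_mem _ h⟩

lemma card_positions : #(positions X σ) = #X :=
  Finset.card_image_of_injective _ (val_injective σ)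

lemma positions_trans_shufflePerm {T : Finset ℕ} (h : #(positions X σ) = #T)
    (hS : positions X σ ⊆ range (Fintype.card α)) (hT : T ⊆ range (Fintype.card α)) :
    positions X (σ.trans (shufflePerm h hS hT)) = T := by
  refine Finset.eq_of_subset_of_card_le ?_ (by rw [← h, card_positions, card_positions])
  intro t ht
  obtain ⟨x, hx, rfl⟩ := Finset.mem_image.1 ht
  exact shuffle_mem h (mem_positions.2 hx)

/-- If a family of orderings is stable under moving the elements of `X` within a window, without
changing the order on `X` and on its complement, then the positions of `X` are uniformly distributed
in the window. -/
lemma sum_positions_eq (Δ : Finset (α ≃ Fin (Fintype.card α))) (X : Finset α)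
    (lo hi : (α ≃ Fin (Fintype.card α)) → ℕ)
    (hwin : ∀ σ ∈ Δ, positions X σ ⊆ Ico (lo σ) (hi σ))
    (hhi : ∀ σ ∈ Δ, hi σ ≤ Fintype.card α)
    (hΔ : ∀ σ ∈ Δ, ∀ τ : α ≃ Fin (Fintype.card α), positions X τ ⊆ Ico (lo σ) (hi σ) →
      (∀ x ∈ X, ∀ y ∈ X, σ x < σ y → τ x < τ y) →
      (∀ x ∉ X, ∀ y ∉ X, σ x < σ y → τ x < τ y) →
      (∀ x ∉ X, ((σ x : ℕ) < lo σ ∨ hi σ ≤ (σ x : ℕ)) → τ x = σ x) →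
      τ ∈ Δ ∧ lo τ = lo σ ∧ hi τ = hi σ)
    (g : ℕ → ℕ → Finset ℕ → ℝ) :
    ∑ σ ∈ Δ, g (lo σ) (hi σ) (positions X σ) =
      ∑ σ ∈ Δ, (∑ T ∈ powersetCard #X (Ico (lo σ) (hi σ)), g (lo σ) (hi σ) T) /
        ((hi σ - lo σ).choose #X : ℝ) := by
  have hrange : ∀ σ ∈ Δ, ∀ T ⊆ Ico (lo σ) (hi σ), T ⊆ range (Fintype.card α) := by
    intro σ hσ T hT t ht
    have := Finset.mem_Ico.1 (hT ht)
    have := hhi σ hσ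
    rw [Finset.mem_range]
    omega
  have hL : ∀ σ ∈ Δ, g (lo σ) (hi σ) (positions X σ) =
      ∑ _T ∈ powersetCard #X (Ico (lo σ) (hi σ)),
        g (lo σ) (hi σ) (positions X σ) / ((hi σ - lo σ).choose #X : ℝ) := by
    intro σ hσ
    rw [Finset.sum_const, Finset.card_powersetCard, Nat.card_Ico, nsmul_eq_mul]
    have hle : #X ≤ hi σ - lo σ := by
      rw [← Nat.card_Ico, ← card_positions (X := X) (σ := σ)]
      exact Finset.card_le_card (hwin σ hσ)
    have : ((hi σ - lo σ).choose #X : ℝ) ≠ 0 := by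
      exact_mod_cast (Nat.choose_pos hle).ne'
    field_simp
  rw [Finset.sum_congr rfl hL]
  simp only [Finset.sum_div]
  rw [Finset.sum_sigma', Finset.sum_sigma']
  have hmem : ∀ p ∈ Δ.sigma fun σ => powersetCard #X (Ico (lo σ) (hi σ)),
      p.1 ∈ Δ ∧ p.2 ⊆ Ico (lo p.1) (hi p.1) ∧ #(positions X p.1) = #p.2 := by
    intro p hp
    rw [Finset.mem_sigma, Finset.mem_powersetCard] at hp
    exact ⟨hp.1, hp.2.1, by rw [card_positions, hp.2.2]⟩
  let f : ∀ p ∈ Δ.sigma fun σ => powersetCard #X (Ico (lo σ) (hi σ)),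
      (Σ _ : α ≃ Fin (Fintype.card α), Finset ℕ) := fun p hp =>
    ⟨p.1.trans (shufflePerm (hmem p hp).2.2 (hrange p.1 (hmem p hp).1 _ (hwin p.1 (hmem p hp).1))
      (hrange p.1 (hmem p hp).1 _ (hmem p hp).2.1)), positions X p.1⟩
  have hpos : ∀ p hp, positions X (f p hp).1 = p.2 := fun p hp => positions_trans_shufflePerm _ _ _
  have hf : ∀ p hp, (f p hp).1 ∈ Δ ∧ lo (f p hp).1 = lo p.1 ∧ hi (f p hp).1 = hi p.1 := by
    intro p hp
    obtain ⟨h1, h2, h3⟩ := hmem p hp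
    refine hΔ p.1 h1 _ ?_ ?_ ?_ ?_
    · rw [hpos p hp]
      exact h2
    · intro x hx y hy hxy
      exact shuffle_lt_of_mem h3 (mem_positions.2 hx) (mem_positions.2 hy) hxy
    · intro x hx y hy hxy
      exact shuffle_lt_of_notMem (mt mem_positions.1 hx) (mt mem_positions.1 hy) hxy
    · intro x _ hx
      exact Fin.ext (shuffle_eq_self h3 (hwin p.1 h1) h2 hx)
  have hfmem : ∀ p hp, f p hp ∈ Δ.sigma fun σ => powersetCard #X (Ico (lo σ) (hi σ)) := by
    intro p hp
    obtain ⟨h1, h2, h3⟩ := hf p hp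
    rw [Finset.mem_sigma, Finset.mem_powersetCard, h2, h3]
    exact ⟨h1, hwin p.1 (hmem p hp).1, card_positions⟩
  have hff : ∀ p hp, f (f p hp) (hfmem p hp) = p := by
    intro p hp
    refine Sigma.ext ?_ (heq_of_eq (hpos p hp))
    ext x
    change shuffle (positions X (f p hp).1) (positions X p.1)
      (shuffle (positions X p.1) p.2 (p.1 x)) = p.1 x
    rw [hpos p hp, shuffle_shuffle (hmem p hp).2.2]
  refine Finset.sum_bij' f f hfmem hfmem hff hff fun p hp => ?_
  rw [(hf p hp).2.1, (hf p hp).2.2]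

end positions

section chain

variable {α : Type} [Fintype α] {r : α → α → Prop} {σ : α ≃ Fin (Fintype.card α)}

lemma mem_linExts : σ ∈ linExts α r ↔ ∀ i j : α, r i j → σ i ≤ σ j := by
  simp [linExts]

lemma le_of_mem_linExts (hσ : σ ∈ linExts α r) {i j : α} (h : r i j) : (σ i : ℕ) ≤ σ j :=
  mem_linExts.1 hσ i j h

lemma lt_of_mem_linExts (hσ : σ ∈ linExts α r) {i j : α} (h : r i j) (hij : i ≠ j) :
    (σ i : ℕ) < σ j := by
  refine lt_of_le_of_ne (le_of_mem_linExts hσ h) fun he => hij ?_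
  exact val_injective σ he

lemma lt_dN_sub_one_iff (hσ : σ ∈ linExts α r) (i : α) (m : ℕ) :
    m < dN r σ i - 1 ↔ m < σ i ∧ ∀ j ≠ i, r j i → (σ j : ℕ) + m + 1 < σ i := by
  rw [dN]
  split_ifs with h
  · rw [Nat.add_sub_cancel]
    exact ⟨fun hm => ⟨hm, fun j hj hr => absurd (h j hr) hj⟩, fun hm => hm.1⟩
  · push Not at h
    obtain ⟨j₀, hr₀, hj₀⟩ := h
    have hne : {m : ℕ | ∃ j : α, j ≠ i ∧ r j i ∧ m = (σ i : ℕ) - (σ j : ℕ)}.Nonempty :=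
      ⟨_, j₀, hj₀, hr₀, rfl⟩
    have hlt₀ := lt_of_mem_linExts hσ hr₀ hj₀
    constructor
    · intro hm
      have key : ∀ j ≠ i, r j i → (σ j : ℕ) + m + 1 < σ i := by
        intro j hj hr
        have h1 := Nat.sInf_le (show (σ i : ℕ) - (σ j : ℕ) ∈
          {m : ℕ | ∃ j : α, j ≠ i ∧ r j i ∧ m = (σ i : ℕ) - (σ j : ℕ)} from ⟨j, hj, hr, rfl⟩)
        omega
      have := key j₀ hj₀ hr₀
      exact ⟨by omega, key⟩
    · rintro ⟨_, hm⟩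
      obtain ⟨j, hj, hr, he⟩ := Nat.sInf_mem hne
      have := hm j hj hr
      omega

lemma harm_dN_eq (hσ : σ ∈ linExts α r) (i : α) :
    harm (dN r σ i - 1) = ∑ m ∈ range (σ i),
      if ∀ j ≠ i, r j i → (σ j : ℕ) + m + 1 < σ i then (1 : ℝ) / (m + 1) else 0 := by
  rw [harm, ← Finset.sum_filter]
  refine Finset.sum_congr ?_ fun _ _ => rfl
  ext m
  rw [Finset.mem_filter, Finset.mem_range, Finset.mem_range, lt_dN_sub_one_iff hσ]

/-- `X` is a chain of `r` whose elements all have the same predecessors `D` and the same successors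
`U` outside `X`; in a linear extension `σ`, the window that `D` and `U` leave to `X` is
`[lo σ, hi σ)`. -/
structure IsChainWindow (r : α → α → Prop) (X D U : Finset α)
    (lo hi : (α ≃ Fin (Fintype.card α)) → ℕ) : Prop where
  chain : ∀ x ∈ X, ∀ y ∈ X, r x y ∨ r y x
  pred_iff : ∀ x ∈ X, ∀ z ∉ X, r z x ↔ z ∈ D
  succ_iff : ∀ x ∈ X, ∀ z ∉ X, r x z ↔ z ∈ U
  pred_notMem : ∀ z ∈ D, z ∉ X
  succ_notMem : ∀ z ∈ U, z ∉ X
  lo_le_iff : ∀ σ ∈ linExts α r, ∀ t, (∀ z ∈ D, (σ z : ℕ) < t) ↔ lo σ ≤ t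
  hi_le : ∀ σ ∈ linExts α r, hi σ ≤ Fintype.card α
  le_hi_iff : ∀ σ ∈ linExts α r, ∀ t ≤ Fintype.card α, (∀ z ∈ U, t ≤ (σ z : ℕ)) ↔ t ≤ hi σ

namespace IsChainWindow

variable {X D U : Finset α} {lo hi : (α ≃ Fin (Fintype.card α)) → ℕ}

lemma positions_subset (h : IsChainWindow r X D U lo hi) (hσ : σ ∈ linExts α r) :
    positions X σ ⊆ Ico (lo σ) (hi σ) := by
  intro t ht
  obtain ⟨x, hx, rfl⟩ := Finset.mem_image.1 ht
  rw [Finset.mem_Ico]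
  refine ⟨(h.lo_le_iff σ hσ _).1 fun z hz => ?_, (h.le_hi_iff σ hσ _ (σ x).2).1 fun z hz => ?_⟩
  · exact lt_of_mem_linExts hσ ((h.pred_iff x hx z (h.pred_notMem z hz)).2 hz)
      fun he => h.pred_notMem z hz (he ▸ hx)
  · exact lt_of_mem_linExts hσ ((h.succ_iff x hx z (h.succ_notMem z hz)).2 hz)
      fun he => h.succ_notMem z hz (he ▸ hx)

lemma choose_ne_zero (h : IsChainWindow r X D U lo hi) (hσ : σ ∈ linExts α r) :
    ((hi σ - lo σ).choose #X : ℝ) ≠ 0 := by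
  have hle : #X ≤ hi σ - lo σ := by
    rw [← Nat.card_Ico, ← card_positions (X := X) (σ := σ)]
    exact Finset.card_le_card (h.positions_subset hσ)
  exact_mod_cast (Nat.choose_pos hle).ne.symm

/-- The positions of `X` are uniformly distributed in its window. -/
lemma sum_positions (h : IsChainWindow r X D U lo hi) (g : ℕ → ℕ → Finset ℕ → ℝ) :
    ∑ σ ∈ linExts α r, g (lo σ) (hi σ) (positions X σ) =
      ∑ σ ∈ linExts α r, (∑ T ∈ powersetCard #X (Ico (lo σ) (hi σ)), g (lo σ) (hi σ) T) /
        ((hi σ - lo σ).choose #X : ℝ) := by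
  refine sum_positions_eq (linExts α r) X lo hi (fun _ => h.positions_subset) h.hi_le ?_ g
  intro σ hσ τ hwτ hXX hcc hfix
  have hDτ : ∀ z ∈ D, τ z = σ z := fun z hz =>
    hfix z (h.pred_notMem z hz) (Or.inl ((h.lo_le_iff σ hσ _).2 le_rfl z hz))
  have hUσ : ∀ z ∈ U, hi σ ≤ σ z := (h.le_hi_iff σ hσ _ (h.hi_le σ hσ)).2 le_rfl
  have hUτ : ∀ z ∈ U, τ z = σ z := fun z hz => hfix z (h.succ_notMem z hz) (Or.inr (hUσ z hz))
  have hτ : τ ∈ linExts α r := by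
    refine mem_linExts.2 fun i j hr => ?_
    by_cases hij : i = j
    · rw [hij]
    have hlt : σ i < σ j := lt_of_mem_linExts hσ hr hij
    by_cases hi' : i ∈ X <;> by_cases hj' : j ∈ X
    · exact (hXX i hi' j hj' hlt).le
    · have hjU := (h.succ_iff i hi' j hj').1 hr
      have h1 := Finset.mem_Ico.1 (hwτ (mem_positions.2 hi'))
      have h2 := hUσ j hjU
      rw [hUτ j hjU, Fin.le_def]
      omega
    · have hiD := (h.pred_iff j hj' i hi').1 hr
      have h1 := Finset.mem_Ico.1 (hwτ (mem_positions.2 hj'))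
      have h2 := (h.lo_le_iff σ hσ _).2 le_rfl i hiD
      rw [hDτ i hiD, Fin.le_def]
      omega
    · exact (hcc i hi' j hj' hlt).le
  refine ⟨hτ, eq_of_forall_ge_iff fun t => ?_, ?_⟩
  · rw [← h.lo_le_iff σ hσ, ← h.lo_le_iff τ hτ]
    exact forall₂_congr fun z hz => by rw [hDτ z hz]
  · have hiff : ∀ t ≤ Fintype.card α, t ≤ hi τ ↔ t ≤ hi σ := by
      intro t ht
      rw [← h.le_hi_iff σ hσ t ht, ← h.le_hi_iff τ hτ t ht]
      exact forall₂_congr fun z hz => by rw [hUτ z hz]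
    exact le_antisymm ((hiff _ (h.hi_le τ hτ)).1 le_rfl) ((hiff _ (h.hi_le σ hσ)).2 le_rfl)

/-- `QLB` restricted to a chain with a window. -/
lemma sum_harm_dN (h : IsChainWindow r X D U lo hi) :
    ∑ σ ∈ linExts α r, ∑ x ∈ X, harm (dN r σ x - 1) =
      ∑ σ ∈ linExts α r, #X * (harm (hi σ - lo σ) - harm #X) := by
  have hgap : ∀ σ ∈ linExts α r, ∑ x ∈ X, harm (dN r σ x - 1) =
      gapSum (lo σ) (positions X σ) := by
    intro σ hσ
    rw [gapSum, positions, Finset.sum_image (val_injective σ).injOn]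
    refine Finset.sum_congr rfl fun x hx => ?_
    rw [harm_dN_eq hσ, ← Finset.sum_filter, ← Finset.sum_filter]
    refine Finset.sum_congr ?_ fun _ _ => rfl
    ext m
    simp only [Finset.mem_filter, Finset.mem_range, Finset.forall_mem_image]
    constructor
    · rintro ⟨hm, hgt⟩
      have := (h.lo_le_iff σ hσ (σ x - m - 1)).1 fun z hz => by
        have := hgt z (fun he => h.pred_notMem z hz (he ▸ hx))
          ((h.pred_iff x hx z (h.pred_notMem z hz)).2 hz)
        omega
      refine ⟨by omega, fun y hy hyx => ?_⟩
      have hne : y ≠ x := fun he => by simp [he] at hyx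
      refine hgt y hne ((h.chain x hx y hy).resolve_left fun hr => ?_)
      have := lt_of_mem_linExts hσ hr hne.symm
      omega
    · rintro ⟨hm, hgt⟩
      refine ⟨by omega, fun z hz hr => ?_⟩
      by_cases hzX : z ∈ X
      · exact hgt hzX (lt_of_mem_linExts hσ hr hz)
      · have := (h.lo_le_iff σ hσ (σ x - m - 1)).2 (by omega) z ((h.pred_iff x hx z hzX).1 hr)
        omega
  rw [Finset.sum_congr rfl hgap, h.sum_positions fun lo _ T => gapSum lo T]
  refine Finset.sum_congr rfl fun σ hσ => ?_
  rw [sum_gapSum, mul_div_cancel_left₀ _ (h.choose_ne_zero hσ)]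

end IsChainWindow

end chain

section NPoset

variable {n : ℕ}

/-- The chain `A` of `N_k`. -/
abbrev chainA {k : ℕ} (i : Fin k) : NCarrier k := Sum.inl i

/-- The chain `B` of `N_k`. -/
abbrev chainB {k : ℕ} (i : Fin k) : NCarrier k := Sum.inr (Sum.inl i)

/-- The chain `C` of `N_k`. -/
abbrev chainC {k : ℕ} (i : Fin k) : NCarrier k := Sum.inr (Sum.inr (Sum.inl i))

/-- The chain `D` of `N_k`. -/
abbrev chainD {k : ℕ} (i : Fin k) : NCarrier k := Sum.inr (Sum.inr (Sum.inr i))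

lemma chainA_injective {k : ℕ} : Function.Injective (chainA (k := k)) := Sum.inl_injective

lemma chainB_injective {k : ℕ} : Function.Injective (chainB (k := k)) :=
  Sum.inr_injective.comp Sum.inl_injective

lemma chainC_injective {k : ℕ} : Function.Injective (chainC (k := k)) :=
  Sum.inr_injective.comp (Sum.inr_injective.comp Sum.inl_injective)

lemma chainD_injective {k : ℕ} : Function.Injective (chainD (k := k)) :=
  Sum.inr_injective.comp (Sum.inr_injective.comp Sum.inr_injective)

lemma isChainWindow_A : IsChainWindow (NRel (n + 1)) (univ.image chainA) ∅ (univ.image chainB)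
    (fun _ => 0) (fun σ => σ (chainB 0)) where
  chain := by
    simpa [NRel] using fun i j : Fin (n + 1) => le_total i j
  pred_iff := by simp [NRel]
  succ_iff := by simp [NRel]
  pred_notMem := by simp
  succ_notMem := by simp
  lo_le_iff := by simp
  hi_le σ _ := (σ _).2.le
  le_hi_iff σ hσ t _ := by
    simp only [Finset.forall_mem_image, Finset.mem_univ, true_implies]
    exact ⟨fun h => @h 0, fun h i => h.trans
      (le_of_mem_linExts hσ (show NRel _ (chainB 0) (chainB i) from Fin.zero_le i))⟩

lemma isChainWindow_C : IsChainWindow (NRel (n + 1)) (univ.image chainC) ∅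
    (univ.image chainB ∪ univ.image chainD)
    (fun _ => 0) (fun σ => min (σ (chainB 0) : ℕ) (σ (chainD 0))) where
  chain := by
    simpa [NRel] using fun i j : Fin (n + 1) => le_total i j
  pred_iff := by simp [NRel]
  succ_iff := by simp [NRel]
  pred_notMem := by simp
  succ_notMem := by
    simp only [Finset.mem_union, or_imp, forall_and, Finset.forall_mem_image]
    simp
  lo_le_iff := by simp
  hi_le σ _ := (min_le_left _ _).trans (σ _).2.le
  le_hi_iff σ hσ t _ := by
    simp only [Finset.mem_union, or_imp, forall_and, Finset.forall_mem_image, Finset.mem_univ,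
      true_implies, le_min_iff]
    exact ⟨fun ⟨h₁, h₂⟩ => ⟨@h₁ 0, @h₂ 0⟩, fun h => ⟨fun i => h.1.trans
      (le_of_mem_linExts hσ (show NRel _ (chainB 0) (chainB i) from Fin.zero_le i)),
      fun i => h.2.trans
      (le_of_mem_linExts hσ (show NRel _ (chainD 0) (chainD i) from Fin.zero_le i))⟩⟩

lemma isChainWindow_D : IsChainWindow (NRel (n + 1)) (univ.image chainD) (univ.image chainC) ∅
    (fun σ => (σ (chainC (Fin.last n)) : ℕ) + 1) (fun _ => Fintype.card (NCarrier (n + 1))) where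
  chain := by
    simpa [NRel] using fun i j : Fin (n + 1) => le_total i j
  pred_iff := by simp [NRel]
  succ_iff := by simp [NRel]
  pred_notMem := by simp
  succ_notMem := by simp
  lo_le_iff σ hσ t := by
    simp only [Finset.forall_mem_image, Finset.mem_univ, true_implies, Nat.add_one_le_iff]
    exact ⟨fun h => @h (Fin.last n), fun h i => (le_of_mem_linExts hσ
      (show NRel _ (chainC i) (chainC (Fin.last n)) from Fin.le_last i)).trans_lt h⟩
  hi_le _ _ := le_rfl
  le_hi_iff σ hσ t ht := by simpa using ht

lemma isChainWindow_B : IsChainWindow (NRel (n + 1)) (univ.image chainB)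
    (univ.image chainA ∪ univ.image chainC) ∅
    (fun σ => max (σ (chainA (Fin.last n)) : ℕ) (σ (chainC (Fin.last n))) + 1)
    (fun _ => Fintype.card (NCarrier (n + 1))) where
  chain := by
    simpa [NRel] using fun i j : Fin (n + 1) => le_total i j
  pred_iff := by simp [NRel]
  succ_iff := by simp [NRel]
  pred_notMem := by
    simp only [Finset.mem_union, or_imp, forall_and, Finset.forall_mem_image]
    simp
  succ_notMem := by simp
  lo_le_iff σ hσ t := by
    simp only [Finset.mem_union, or_imp, forall_and, Finset.forall_mem_image, Finset.mem_univ,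
      true_implies, Nat.add_one_le_iff, max_lt_iff]
    exact ⟨fun ⟨h₁, h₂⟩ => ⟨@h₁ (Fin.last n), @h₂ (Fin.last n)⟩,
      fun h => ⟨fun i => (le_of_mem_linExts hσ
      (show NRel _ (chainA i) (chainA (Fin.last n)) from Fin.le_last i)).trans_lt h.1,
      fun i => (le_of_mem_linExts hσ
      (show NRel _ (chainC i) (chainC (Fin.last n)) from Fin.le_last i)).trans_lt h.2⟩⟩
  hi_le _ _ := le_rfl
  le_hi_iff σ hσ t ht := by simpa using ht

/-- The anti-automorphism of `N_k`. -/
def dual (k : ℕ) : NCarrier k → NCarrier k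
  | Sum.inl i => chainD i.rev
  | Sum.inr (Sum.inl i) => chainC i.rev
  | Sum.inr (Sum.inr (Sum.inl i)) => chainB i.rev
  | Sum.inr (Sum.inr (Sum.inr i)) => chainA i.rev

lemma dual_involutive (k : ℕ) : Function.Involutive (dual k) := by
  rintro (i | i | i | i) <;> simp [dual]

lemma NRel_dual {k : ℕ} {x y : NCarrier k} (h : NRel k x y) : NRel k (dual k y) (dual k x) := by
  rcases x with i | i | i | i <;> rcases y with j | j | j | j <;> simp_all [dual, NRel]

/-- The reversal of an ordering of `N_k`, composed with the anti-automorphism. -/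
def reversal (k : ℕ) (σ : NCarrier k ≃ Fin (Fintype.card (NCarrier k))) :
    NCarrier k ≃ Fin (Fintype.card (NCarrier k)) :=
  ((dual_involutive k).toPerm.trans σ).trans Fin.revPerm

lemma reversal_val (k : ℕ) (σ : NCarrier k ≃ Fin (Fintype.card (NCarrier k))) (x : NCarrier k) :
    (reversal k σ x : ℕ) = Fintype.card (NCarrier k) - (σ (dual k x) + 1) := by
  simp [reversal]

lemma reversal_reversal (k : ℕ) (σ : NCarrier k ≃ Fin (Fintype.card (NCarrier k))) :
    reversal k (reversal k σ) = σ := by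
  ext x
  simp [reversal, dual_involutive k x]

lemma reversal_mem (k : ℕ) {σ : NCarrier k ≃ Fin (Fintype.card (NCarrier k))}
    (hσ : σ ∈ linExts (NCarrier k) (NRel k)) : reversal k σ ∈ linExts (NCarrier k) (NRel k) := by
  refine mem_linExts.2 fun i j h => ?_
  have := le_of_mem_linExts hσ (NRel_dual h)
  rw [Fin.le_def, reversal_val, reversal_val]
  omega

lemma sum_reversal (k : ℕ) (f : (NCarrier k ≃ Fin (Fintype.card (NCarrier k))) → ℝ) :
    ∑ σ ∈ linExts (NCarrier k) (NRel k), f (reversal k σ) =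
      ∑ σ ∈ linExts (NCarrier k) (NRel k), f σ :=
  Finset.sum_bij' (fun σ _ => reversal k σ) (fun σ _ => reversal k σ)
    (fun _ => reversal_mem k) (fun _ => reversal_mem k)
    (fun σ _ => reversal_reversal k σ) (fun σ _ => reversal_reversal k σ) fun _ _ => rfl

lemma sum_harm_reversal_D : ∑ σ ∈ linExts (NCarrier (n + 1)) (NRel (n + 1)),
      harm (Fintype.card (NCarrier (n + 1)) - ((σ (chainC (Fin.last n)) : ℕ) + 1)) =
    ∑ σ ∈ linExts (NCarrier (n + 1)) (NRel (n + 1)), harm (σ (chainB 0)) := by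
  rw [← sum_reversal]
  refine Finset.sum_congr rfl fun σ _ => congrArg harm ?_
  have h : dual (n + 1) (chainC (Fin.last n)) = chainB 0 := by simp [dual]
  rw [reversal_val, h]
  have := (σ (chainB 0)).2
  omega

lemma sum_harm_reversal_B : ∑ σ ∈ linExts (NCarrier (n + 1)) (NRel (n + 1)),
      harm (Fintype.card (NCarrier (n + 1)) -
        (max (σ (chainA (Fin.last n)) : ℕ) (σ (chainC (Fin.last n))) + 1)) =
    ∑ σ ∈ linExts (NCarrier (n + 1)) (NRel (n + 1)),
      harm (min (σ (chainB 0) : ℕ) (σ (chainD 0))) := by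
  rw [← sum_reversal]
  refine Finset.sum_congr rfl fun σ _ => congrArg harm ?_
  have hC : dual (n + 1) (chainC (Fin.last n)) = chainB 0 := by simp [dual]
  have hA : dual (n + 1) (chainA (Fin.last n)) = chainD 0 := by simp [dual]
  rw [reversal_val, reversal_val, hA, hC]
  have := (σ (chainB 0)).2
  have := (σ (chainD 0)).2
  omega

lemma card_image_univ {k : ℕ} {β : Type} [DecidableEq β] {f : Fin k → β}
    (hf : Function.Injective f) :
    #(univ.image f) = k := by
  rw [Finset.card_image_of_injective _ hf, Finset.card_univ, Fintype.card_fin]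

lemma sum_univ_NCarrier {k : ℕ} (f : NCarrier k → ℝ) :
    ∑ x, f x = ∑ x ∈ univ.image chainA, f x + ∑ x ∈ univ.image chainB, f x +
      ∑ x ∈ univ.image chainC, f x + ∑ x ∈ univ.image chainD, f x := by
  rw [Finset.sum_image chainA_injective.injOn, Finset.sum_image chainB_injective.injOn,
    Finset.sum_image chainC_injective.injOn, Finset.sum_image chainD_injective.injOn]
  simp only [Fintype.sum_sum_type]
  ring

/-- The unnormalized `QLB` of `N_k` in terms of the positions of `b_1` and `d_1`. -/
lemma sum_sum_harm_dN : ∑ σ ∈ linExts (NCarrier (n + 1)) (NRel (n + 1)),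
      ∑ x, harm (dN (NRel (n + 1)) σ x - 1) =
    ∑ σ ∈ linExts (NCarrier (n + 1)) (NRel (n + 1)), 2 * ((n + 1 : ℕ) : ℝ) *
      (harm (σ (chainB 0)) + harm (min (σ (chainB 0) : ℕ) (σ (chainD 0))) - 2 * harm (n + 1)) := by
  have hA := (isChainWindow_A (n := n)).sum_harm_dN
  have hB := (isChainWindow_B (n := n)).sum_harm_dN
  have hC := (isChainWindow_C (n := n)).sum_harm_dN
  have hD := (isChainWindow_D (n := n)).sum_harm_dN
  rw [card_image_univ chainA_injective] at hA
  rw [card_image_univ chainB_injective] at hB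
  rw [card_image_univ chainC_injective] at hC
  rw [card_image_univ chainD_injective] at hD
  rw [← Finset.mul_sum, Finset.sum_sub_distrib] at hA hB hC hD
  rw [sum_harm_reversal_D] at hD
  rw [sum_harm_reversal_B] at hB
  simp only [Nat.sub_zero] at hA hC
  simp only [sum_univ_NCarrier, Finset.sum_add_distrib]
  rw [hA, hB, hC, hD, ← Finset.mul_sum, Finset.sum_sub_distrib, Finset.sum_add_distrib,
    ← Finset.mul_sum (linExts _ _) (fun _ => harm (n + 1))]
  ring

lemma two_mul_le_chainB_zero {σ : NCarrier (n + 1) ≃ Fin (Fintype.card (NCarrier (n + 1)))}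
    (hσ : σ ∈ linExts (NCarrier (n + 1)) (NRel (n + 1))) :
    2 * (n + 1) ≤ σ (chainB 0) := by
  have h : positions (univ.image chainA ∪ univ.image chainC) σ ⊆ range (σ (chainB 0)) := by
    intro t ht
    obtain ⟨x, hx, rfl⟩ := Finset.mem_image.1 ht
    rw [Finset.mem_range]
    rcases Finset.mem_union.1 hx with hx | hx <;> obtain ⟨i, _, rfl⟩ := Finset.mem_image.1 hx <;>
      exact lt_of_mem_linExts hσ (by simp [NRel]) (by simp)
  have hcard := Finset.card_le_card h
  rw [card_positions, Finset.card_range, Finset.card_union_of_disjoint,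
    card_image_univ chainA_injective,
    card_image_univ chainC_injective] at hcard
  · omega
  · rw [Finset.disjoint_left]
    simp

lemma min_eq_nth_notMem {σ : NCarrier (n + 1) ≃ Fin (Fintype.card (NCarrier (n + 1)))}
    (hσ : σ ∈ linExts (NCarrier (n + 1)) (NRel (n + 1))) :
    min (σ (chainB 0) : ℕ) (σ (chainD 0)) =
      Nat.nth (· ∉ positions (univ.image chainA) σ) (n + 1) := by
  have hmem : min (σ (chainB 0) : ℕ) (σ (chainD 0)) ∉ positions (univ.image chainA) σ := by
    rcases min_choice (σ (chainB 0) : ℕ) (σ (chainD 0)) with h | h <;> rw [h, mem_positions] <;>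
      simp
  have hcount : Nat.count (· ∉ positions (univ.image chainA) σ)
      (min (σ (chainB 0) : ℕ) (σ (chainD 0))) = n + 1 := by
    rw [Nat.count_eq_card_filter_range]
    refine Eq.trans (congrArg _ ?_)
      (card_positions (X := univ.image chainC) (σ := σ) |>.trans (card_image_univ chainC_injective))
    ext t
    rw [Finset.mem_filter, Finset.mem_range]
    constructor
    · rintro ⟨hlt, ht⟩
      rw [lt_min_iff] at hlt
      obtain ⟨x, hx⟩ := σ.surjective ⟨t, hlt.1.trans (σ _).2⟩
      obtain rfl : (σ x : ℕ) = t := by rw [hx]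
      rw [mem_positions] at ht ⊢
      rcases x with i | i | i | i
      · simp at ht
      · have := le_of_mem_linExts hσ (show NRel _ (chainB 0) (chainB i) from Fin.zero_le i)
        exact absurd hlt.1 (not_lt.2 this)
      · simp
      · have := le_of_mem_linExts hσ (show NRel _ (chainD 0) (chainD i) from Fin.zero_le i)
        exact absurd hlt.2 (not_lt.2 this)
    · intro ht
      obtain ⟨x, hx, rfl⟩ := Finset.mem_image.1 ht
      obtain ⟨i, _, rfl⟩ := Finset.mem_image.1 hx
      rw [mem_positions]
      refine ⟨lt_min (lt_of_mem_linExts hσ (by simp [NRel]) (by simp))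
        (lt_of_mem_linExts hσ (by simp [NRel]) (by simp)), by simp⟩
  have h := Nat.nth_count (p := (· ∉ positions (univ.image chainA) σ)) hmem
  rw [hcount] at h
  exact h.symm

lemma two_mul_harm_le (k j : ℕ) :
    2 * harm (2 * k) ≤ 2 * harm (2 * k + j) - harm (k + j) + harm k := by
  induction j with
  | zero => simp
  | succ j ih =>
    rw [← add_assoc, ← add_assoc, harm_succ, harm_succ]
    have : 1 / ((k + j : ℕ) + 1 : ℝ) ≤ 2 * (1 / ((2 * k + j : ℕ) + 1 : ℝ)) := by
      rw [mul_one_div, div_le_div_iff₀ (by positivity) (by positivity)]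
      push_cast
      linarith [Nat.cast_nonneg (α := ℝ) j]
    linarith

lemma sum_harm_ge : ∑ _σ ∈ linExts (NCarrier (n + 1)) (NRel (n + 1)), 2 * harm (2 * (n + 1)) ≤
    ∑ σ ∈ linExts (NCarrier (n + 1)) (NRel (n + 1)),
      (harm (σ (chainB 0)) + harm (min (σ (chainB 0) : ℕ) (σ (chainD 0)))) := by
  have h := (isChainWindow_A (n := n)).sum_positions
    fun _ hi T => harm hi + harm (Nat.nth (· ∉ T) (n + 1))
  have hmin : ∀ σ ∈ linExts (NCarrier (n + 1)) (NRel (n + 1)),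
      harm (σ (chainB 0)) + harm (min (σ (chainB 0) : ℕ) (σ (chainD 0))) =
        harm (σ (chainB 0)) + harm (Nat.nth (· ∉ positions (univ.image chainA) σ) (n + 1)) :=
    fun σ hσ => by rw [min_eq_nth_notMem hσ]
  rw [Finset.sum_congr rfl hmin, h]
  refine Finset.sum_le_sum fun σ hσ => ?_
  have hpos := (isChainWindow_A (n := n)).choose_ne_zero hσ
  rw [card_image_univ chainA_injective] at hpos ⊢
  obtain ⟨j, hj⟩ := Nat.exists_eq_add_of_le (two_mul_le_chainB_zero hσ)
  have hj' : (σ (chainB 0) : ℕ) = n + 1 + j + (n + 1) := by omega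
  rw [Nat.sub_zero, ← Finset.range_eq_Ico] at *
  rw [hj', Finset.sum_add_distrib, sum_harm_nth_notMem, Finset.sum_const,
    Finset.card_powersetCard, Finset.card_range, nsmul_eq_mul, ← mul_add,
    mul_div_cancel_left₀ _ (hj' ▸ hpos), ← hj', hj]
  linarith [two_mul_harm_le (n + 1) j]

/-- Positions of a linear extension of `N_k` that lists the chains in the order `A`, `C`, `B`, `D`. -/
def positionACBD {k : ℕ} : NCarrier k → ℕ
  | Sum.inl i => i
  | Sum.inr (Sum.inl i) => 2 * k + i
  | Sum.inr (Sum.inr (Sum.inl i)) => k + i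
  | Sum.inr (Sum.inr (Sum.inr i)) => 3 * k + i

lemma positionACBD_lt {k : ℕ} (x : NCarrier k) : positionACBD x < Fintype.card (NCarrier k) := by
  simp only [Fintype.card_sum, Fintype.card_fin]
  rcases x with i | i | i | i <;> simp only [positionACBD] <;> omega

lemma positionACBD_injective {k : ℕ} : Function.Injective (positionACBD (k := k)) := by
  intro x y h
  rcases x with i | i | i | i <;> rcases y with j | j | j | j <;>
    simp only [positionACBD] at h <;> first | omega | (congr; omega)

lemma positionACBD_le {k : ℕ} {x y : NCarrier k} (h : NRel k x y) :
    positionACBD x ≤ positionACBD y := by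
  rcases x with i | i | i | i <;> rcases y with j | j | j | j <;>
    simp only [NRel, Fin.le_def] at h <;> simp only [positionACBD] <;> omega

lemma linExts_NRel_nonempty (k : ℕ) : (linExts (NCarrier k) (NRel k)).Nonempty := by
  have hinj : Function.Injective fun x : NCarrier k =>
      (⟨positionACBD x, positionACBD_lt x⟩ : Fin (Fintype.card (NCarrier k))) :=
    fun x y h => positionACBD_injective (Fin.mk.inj h)
  exact ⟨Equiv.ofBijective _ ((Fintype.bijective_iff_injective_and_card _).2
    ⟨hinj, (Fintype.card_fin _).symm⟩), mem_linExts.2 fun _ _ => positionACBD_le⟩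

end NPoset

lemma le_QLB_NRel (k : ℕ) (hk : 1 ≤ k) :
    4 * (k : ℝ) * (harm (2 * k) - harm k) ≤ QLB (NCarrier k) (NRel k) := by
  obtain ⟨n, rfl⟩ := Nat.exists_eq_add_of_le' hk
  have hpos : (0 : ℝ) < (#(linExts (NCarrier (n + 1)) (NRel (n + 1))) : ℝ) := by
    exact_mod_cast (linExts_NRel_nonempty (n + 1)).card_pos
  have h := sum_harm_ge (n := n)
  rw [QLB, sum_sum_harm_dN, le_div_iff₀ hpos, ← Finset.mul_sum, Finset.sum_sub_distrib]
  rw [Finset.sum_const, nsmul_eq_mul] at h ⊢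
  have hk' : (0 : ℝ) ≤ 2 * ((n + 1 : ℕ) : ℝ) := by positivity
  refine le_trans (le_of_eq ?_) (mul_le_mul_of_nonneg_left (sub_le_sub_right h _) hk')
  ring

lemma half_le_harm_sub (k : ℕ) (hk : 1 ≤ k) : 1 / 2 ≤ harm (2 * k) - harm k := by
  induction k, hk using Nat.le_induction with
  | base => norm_num [harm, Finset.sum_range_succ]
  | succ k hk ih =>
    have h2 : 2 * (k + 1) = 2 * k + 1 + 1 := by ring
    rw [h2, harm_succ, harm_succ, harm_succ]
    have : 1 / ((k : ℝ) + 1) ≤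
        1 / (((2 * k : ℕ) : ℝ) + 1) + 1 / (((2 * k + 1 : ℕ) : ℝ) + 1) := by
      push_cast
      rw [div_add_div _ _ (by positivity) (by positivity),
        div_le_div_iff₀ (by positivity) (by positivity)]
      nlinarith [Nat.cast_nonneg (α := ℝ) k]
    linarith

/-- There is `c > 0` with `QLB(N_k) ≥ c k` for all `k ≥ 1`;
in fact `QLB(N_k) ≥ 4k (H_{2k} − H_k)`. -/
theorem stmt_14 :
    (∃ c : ℝ, 0 < c ∧ ∀ k : ℕ, 1 ≤ k →
      c * (k : ℝ) ≤ QLB (NCarrier k) (NRel k)) ∧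
    (∀ k : ℕ, 1 ≤ k →
      4 * (k : ℝ) * (harm (2 * k) - harm k) ≤ QLB (NCarrier k) (NRel k)) := by
  refine ⟨⟨2, two_pos, fun k hk => ?_⟩, le_QLB_NRel⟩
  refine le_trans ?_ (le_QLB_NRel k hk)
  have hk' : (0 : ℝ) ≤ 4 * (k : ℝ) := by positivity
  linarith [mul_le_mul_of_nonneg_left (half_le_harm_sub k hk) hk']
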